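/- arXiv:1707.03894 — 14 statements merged into one kernel-verified Lean document; each statement's English description precedes it below -/
import Mathlib

section
/- Assume the abc conjecture: for every ε > 0 there exists a constant C > 0 such that for all positive integers a, b, c with a + b = c and gcd(a,b) = 1, one has c ≤ C·(rad(a·b·c))^{1+ε}. Then the set of tuples (q,n,ℓ,b,y,c) of positive integers with q ≥ 2, n ≥ 2, ℓ ≥ 1, b ≥ 2, y ≥ 2, such that the triple (q,n,ℓ) is inadmissible, b^{ℓ−1} ≤ c < b^ℓ, and y^q·(b^ℓ − 1) = c·(b^{nℓ} − 1), is finite. -/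
/-- A triple `(q, n, ℓ)` of integers with `q, n ≥ 2` and `ℓ ≥ 1` is *admissible* if
`(q, n) = (2, 2)`, or `(n, ℓ) = (2, 1)`, or `(q, n, ℓ)` is one of the seven sporadic triples. -/
def Admissible (q n ℓ : ℕ) : Prop :=
  (q = 2 ∧ n = 2) ∨ (n = 2 ∧ ℓ = 1) ∨
    (q, n, ℓ) ∈ ({(2,3,1), (2,3,2), (3,2,2), (3,2,3), (3,3,1), (2,4,1), (4,2,2)} :
      Set (ℕ × ℕ × ℕ))

/-- The radical of a positive integer: the product of its distinct prime divisors. -/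
def rad (m : ℕ) : ℕ := ∏ p ∈ m.primeFactors, p

theorem aux_arith (q n l : ℕ) (hq : 2 ≤ q) (hn : 2 ≤ n) (hl : 1 ≤ l)
    (h : ¬ Admissible q n l) : 24 * (q + l * q + n * l) ≤ 23 * (n * l * q) := by
  simp only [Admissible, Set.mem_insert_iff, Set.mem_singleton_iff, Prod.mk.injEq, not_or,
    not_and] at h
  obtain ⟨h1, h2, h3, h4, h5, h6, h7, h8, h9⟩ := h
  rcases Nat.lt_or_ge q 5 with hq5 | hq5
  · rcases Nat.lt_or_ge n 5 with hn5 | hn5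
    · interval_cases q <;> interval_cases n <;> simp at * <;> omega
    · have : 5 * l ≤ n * l := Nat.mul_le_mul_right _ hn5
      interval_cases q <;> omega
  · obtain ⟨k, rfl⟩ := Nat.exists_eq_add_of_le hq5
    rcases Nat.lt_or_ge n 3 with hn3 | hn3
    · have : n = 2 := by omega
      subst this
      have hl2 : 2 ≤ l := by
        have := h2 rfl
        omega
      nlinarith [Nat.mul_le_mul_right k hl2]
    · have : 3 * l ≤ n * l := Nat.mul_le_mul_right _ hn3
      nlinarith [Nat.mul_le_mul_right k this, Nat.mul_le_mul_right k hl]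

theorem aux_rad (q n l b y c : ℕ) (hb : 2 ≤ b) (hy : 2 ≤ y) (hl : 1 ≤ l)
    (h : y ^ q * (b ^ l - 1) = c * (b ^ (n * l) - 1)) :
    rad (1 * (b ^ (n * l) - 1) * b ^ (n * l)) ≤ b * (b ^ l - 1) * y := by
  have hB : b ≤ b ^ l := Nat.le_self_pow (by omega) b
  apply Nat.le_of_dvd
  · have : 0 < b ^ l - 1 := by omega
    positivity
  · unfold rad
    apply Finset.prod_primes_dvd
    · intro p hp
      exact (Nat.prime_of_mem_primeFactors hp).prime
    · intro p hp
      have pp := Nat.prime_of_mem_primeFactors hp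
      have hd := Nat.dvd_of_mem_primeFactors hp
      rw [one_mul] at hd
      rcases pp.dvd_mul.1 hd with h1 | h1
      · have : p ∣ y ^ q * (b ^ l - 1) := h ▸ Dvd.dvd.mul_left h1 c
        rcases pp.dvd_mul.1 this with h2 | h2
        · exact Dvd.dvd.mul_left (pp.dvd_of_dvd_pow h2) _
        · exact Dvd.dvd.mul_right (Dvd.dvd.mul_left h2 _) _
      · exact Dvd.dvd.mul_right (Dvd.dvd.mul_right (pp.dvd_of_dvd_pow h1) _) _

theorem aux_y (q n l b y c : ℕ) (hb : 2 ≤ b) (hl : 1 ≤ l) (hc : c < b ^ l)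
    (h : y ^ q * (b ^ l - 1) = c * (b ^ (n * l) - 1)) : y ^ q ≤ b ^ (n * l) := by
  have hB : b ≤ b ^ l := Nat.le_self_pow (by omega) b
  have h0 : 0 < b ^ l - 1 := by omega
  have h1 : c ≤ b ^ l - 1 := by omega
  have : y ^ q * (b ^ l - 1) ≤ b ^ (n * l) * (b ^ l - 1) := by
    rw [h, mul_comm]
    exact Nat.mul_le_mul (Nat.sub_le _ _) h1
  exact Nat.le_of_mul_le_mul_right this h0

theorem aux_pow (q n l b y c : ℕ) (hq : 2 ≤ q) (hn : 2 ≤ n) (hl : 1 ≤ l) (hb : 2 ≤ b)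
    (hy : 2 ≤ y) (hA : ¬ Admissible q n l) (hc : c < b ^ l)
    (h : y ^ q * (b ^ l - 1) = c * (b ^ (n * l) - 1)) :
    rad (1 * (b ^ (n * l) - 1) * b ^ (n * l)) ^ 24 ≤ (b ^ (n * l)) ^ 23 := by
  have h1 := aux_rad q n l b y c hb hy hl h
  have h2 := aux_y q n l b y c hb hl hc h
  have h3 := aux_arith q n l hq hn hl hA
  set r := rad (1 * (b ^ (n * l) - 1) * b ^ (n * l))
  have h4 : r ≤ b * b ^ l * y :=
    h1.trans (Nat.mul_le_mul_right _ (Nat.mul_le_mul_left _ (Nat.sub_le _ _)))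
  have h5 : r ^ q ≤ b ^ (q + l * q + n * l) := by
    calc r ^ q ≤ (b * b ^ l * y) ^ q := Nat.pow_le_pow_left h4 q
      _ = b ^ q * b ^ (l * q) * y ^ q := by rw [mul_pow, mul_pow, pow_mul]
      _ ≤ b ^ q * b ^ (l * q) * b ^ (n * l) := Nat.mul_le_mul_left _ h2
      _ = _ := by rw [pow_add, pow_add]
  refine (Nat.pow_le_pow_iff_left (n := q) (by omega)).1 ?_
  calc (r ^ 24) ^ q = (r ^ q) ^ 24 := by rw [← pow_mul, ← pow_mul, mul_comm]
    _ ≤ (b ^ (q + l * q + n * l)) ^ 24 := Nat.pow_le_pow_left h5 _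
    _ = b ^ (24 * (q + l * q + n * l)) := by rw [← pow_mul, mul_comm]
    _ ≤ b ^ (23 * (n * l * q)) := Nat.pow_le_pow_right (by omega) h3
    _ = _ := by rw [← pow_mul, ← pow_mul]; congr 1; ring

theorem finitely_many_inadmissible_solutions
    (abc : ∀ ε : ℝ, 0 < ε → ∃ C : ℝ, 0 < C ∧ ∀ a b c : ℕ, 0 < a → 0 < b → 0 < c →
      a + b = c → Nat.gcd a b = 1 → (c : ℝ) ≤ C * (rad (a * b * c) : ℝ) ^ (1 + ε)) :
    {x : ℕ × ℕ × ℕ × ℕ × ℕ × ℕ |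
      match x with
      | (q, n, ℓ, b, y, c) =>
        2 ≤ q ∧ 2 ≤ n ∧ 1 ≤ ℓ ∧ 2 ≤ b ∧ 2 ≤ y ∧ 0 < c ∧ ¬ Admissible q n ℓ ∧
          b ^ (ℓ - 1) ≤ c ∧ c < b ^ ℓ ∧ y ^ q * (b ^ ℓ - 1) = c * (b ^ (n * ℓ) - 1)}.Finite := by
  obtain ⟨C, hC, H⟩ := abc (1 / 24) (by norm_num)
  obtain ⟨N, hN⟩ := exists_nat_ge (C ^ 576)
  refine (Set.finite_Iic ((N, N, N, N, N, N) : ℕ × ℕ × ℕ × ℕ × ℕ × ℕ)).subset ?_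
  rintro ⟨q, n, l, b, y, c⟩ ⟨hq, hn, hl, hb, hy, hc0, hA, -, hc, h⟩
  have hp := aux_pow q n l b y c hq hn hl hb hy hA hc h
  have hyM := aux_y q n l b y c hb hl hc h
  have hnl : n ≤ n * l := Nat.le_mul_of_pos_right n hl
  have hnl' : l ≤ n * l := Nat.le_mul_of_pos_left l (by omega)
  have hlt : n * l < b ^ (n * l) := Nat.lt_pow_self (by omega)
  have hbM : b ≤ b ^ (n * l) := Nat.le_self_pow (by omega) b
  have hcM : b ^ l ≤ b ^ (n * l) := Nat.pow_le_pow_right (by omega) hnl'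
  have hqy : q < y ^ q := Nat.lt_pow_self (by omega)
  have hyy : y ≤ y ^ q := Nat.le_self_pow (by omega) y
  have h1 := H 1 (b ^ (n * l) - 1) (b ^ (n * l)) one_pos (by omega) (by omega) (by omega)
    (Nat.gcd_one_left _)
  set r := rad (1 * (b ^ (n * l) - 1) * b ^ (n * l))
  set M := b ^ (n * l)
  have hM0 : (0 : ℝ) < M := by
    have : 0 < M := by omega
    exact_mod_cast this
  have hp' : (r : ℝ) ^ 24 ≤ (M : ℝ) ^ 23 := by exact_mod_cast hp
  have h2 : ((r : ℝ) ^ (1 + 1 / 24 : ℝ)) ^ 576 = ((r : ℝ) ^ 24) ^ 25 := by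
    rw [← Real.rpow_natCast, ← Real.rpow_mul (by positivity), ← pow_mul, ← Real.rpow_natCast]
    norm_num
  have h3 : (M : ℝ) ^ 575 * M ≤ (M : ℝ) ^ 575 * C ^ 576 := by
    calc (M : ℝ) ^ 575 * M = (M : ℝ) ^ 576 := (pow_succ _ _).symm
      _ ≤ (C * (r : ℝ) ^ (1 + 1 / 24 : ℝ)) ^ 576 := pow_le_pow_left₀ hM0.le h1 _
      _ = C ^ 576 * ((r : ℝ) ^ 24) ^ 25 := by rw [mul_pow, h2]
      _ ≤ C ^ 576 * ((M : ℝ) ^ 23) ^ 25 := by gcongr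
      _ = _ := by rw [← pow_mul, mul_comm]
  have h4 : (M : ℝ) ≤ N := (le_of_mul_le_mul_left h3 (by positivity)).trans hN
  have h5 : M ≤ N := by exact_mod_cast h4
  simp only [Set.mem_Iic, Prod.mk_le_mk]
  refine ⟨?_, ?_, ?_, ?_, ?_, ?_⟩ <;> omega
end

section
/- For each integer ℓ ≥ 1, the set of integers b ≥ 2 for which there exist positive integers y and c with b^{ℓ−1} ≤ c < b^ℓ and y² = c·(b^ℓ + 1) is infinite. -/
theorem infinitely_many_bases_square_double_block (ℓ : ℕ) (hℓ : 1 ≤ ℓ) :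
    {b : ℕ | 2 ≤ b ∧ ∃ y c : ℕ, 0 < y ∧ 0 < c ∧
      b ^ (ℓ - 1) ≤ c ∧ c < b ^ ℓ ∧ y ^ 2 = c * (b ^ ℓ + 1)}.Infinite := by
  obtain ⟨n, rfl⟩ : ∃ n, ℓ = n + 1 := ⟨ℓ - 1, by omega⟩
  simp only [Nat.add_sub_cancel]
  set a := 2 * (n + 1) with ha
  obtain ⟨e, he⟩ : ∃ e, a ^ (n + 1) = e + 1 :=
    ⟨a ^ (n + 1) - 1, by have : 0 < a ^ (n + 1) := by positivity
                         omega⟩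
  apply Set.infinite_of_not_bddAbove
  rintro ⟨B, hB⟩
  obtain ⟨b, hb, hbB, m, hm⟩ : ∃ b, 4 ≤ b ∧ B < b ∧ ∃ m, b ^ (n + 1) + 1 = (e + 2) ^ 2 * m := by
    refine ⟨a + (2 + B * (e + 2)) * (e + 2), by nlinarith [Nat.zero_le (B * (e + 2) * (e + 2))],
      by nlinarith [Nat.zero_le (B * e), Nat.zero_le (B * e * e)], ?_⟩
    obtain ⟨k, hk⟩ := Polynomial.powAddExpansion a ((2 + B * (e + 2)) * (e + 2)) (n + 1)
    refine ⟨1 + (n + 1) * a ^ n * B + k * (2 + B * (e + 2)) ^ 2, ?_⟩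
    rw [hk, he]
    have h2 : 2 * (n + 1) * a ^ n = e + 1 := by rw [← he, pow_succ, ha]; ring
    simp only [Nat.add_sub_cancel]
    push_cast
    linear_combination (e + 2) * h2
  have hpos : 0 < b ^ n := by positivity
  have hp : b ^ (n + 1) = b ^ n * b := pow_succ _ _
  have hm0 : 0 < m := by
    rcases Nat.eq_zero_or_pos m with h | h
    · simp [h] at hm
    · exact h
  have he0 : 1 ≤ e := by
    have : 2 ≤ a ^ (n + 1) := le_trans (by omega) (Nat.le_self_pow (Nat.succ_ne_zero n) a)
    omega
  have := hB (a := b) ⟨by omega, (e + 1) * (e + 2) * m, (e + 1) ^ 2 * m, by positivity,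
    by positivity, ?_, ?_, ?_⟩
  · omega
  · have h1 : b ^ n * 4 ≤ b ^ n * b := Nat.mul_le_mul_left _ hb
    have h2 : (e + 2) ^ 2 * m ≤ 4 * (e + 1) ^ 2 * m := Nat.mul_le_mul_right _ (by nlinarith)
    nlinarith
  · nlinarith [Nat.zero_le (e * m)]
  · rw [hm]; ring
end

section
/- For every integer b ≥ 2, there exists a prime p ≥ 5 such that p does not divide b and b has even multiplicative order modulo p², i.e., the order of b in the multiplicative group of integers modulo p² is even. -/
theorem exists_prime_even_order_mod_sq (b : ℕ) (hb : 2 ≤ b) :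
    ∃ p : ℕ, p.Prime ∧ 5 ≤ p ∧ ¬ p ∣ b ∧ Even (orderOf (b : ZMod (p ^ 2))) := by
  have key : ∃ N : ℕ, N ≠ 1 ∧ N % 2 = 1 ∧ N ∣ b ^ 2 + 1 := by
    rcases Nat.even_or_odd' b with ⟨k, rfl | rfl⟩
    · refine ⟨(2 * k) ^ 2 + 1, ?_, ?_, dvd_rfl⟩
      · have : 0 < (2 * k) ^ 2 := by positivity
        omega
      · have : (2 * k) ^ 2 + 1 = 2 * (2 * k ^ 2) + 1 := by ring
        omega
    · refine ⟨2 * (k ^ 2 + k) + 1, ?_, by omega, ⟨2, by ring⟩⟩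
      omega
  obtain ⟨N, hN1, hN2, hN⟩ := key
  obtain ⟨p, hp, hpN⟩ := Nat.exists_prime_and_dvd hN1
  have hpd : p ∣ b ^ 2 + 1 := hpN.trans hN
  have h2 : p ≠ 2 := by rintro rfl; omega
  have h3 : p ≠ 3 := by
    rintro rfl
    have h := Nat.mod_eq_zero_of_dvd hpd
    have h' : b % 3 = 0 ∨ b % 3 = 1 ∨ b % 3 = 2 := by omega
    rcases h' with h' | h' | h' <;> simp [Nat.add_mod, Nat.pow_mod, h'] at h
  have h4 : p ≠ 4 := by rintro rfl; revert hp; decide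
  have hp2 := hp.two_le
  refine ⟨p, hp, by omega, ?_, ?_⟩
  · intro h
    have h1 : p ∣ 1 := (Nat.dvd_add_right (dvd_pow h two_ne_zero)).1 hpd
    exact hp.one_lt.ne' (Nat.dvd_one.1 h1)
  · by_contra hodd
    rw [Nat.not_even_iff_odd] at hodd
    haveI : Fact p.Prime := ⟨hp⟩
    haveI : Fact (2 < p) := ⟨by omega⟩
    have e := pow_orderOf_eq_one (b : ZMod (p ^ 2))
    set n := orderOf (b : ZMod (p ^ 2))
    have e1 : (b : ZMod p) ^ n = 1 := by
      have := congrArg (ZMod.castHom (dvd_pow_self p two_ne_zero) (ZMod p)) e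
      rwa [map_pow, map_natCast, map_one] at this
    have e2 : (b : ZMod p) ^ 2 = -1 := by
      have := (ZMod.natCast_eq_zero_iff (b ^ 2 + 1) p).2 hpd
      push_cast at this
      exact eq_neg_of_add_eq_zero_left this
    have e3 : (-1 : ZMod p) = 1 := by
      rw [← hodd.neg_one_pow, ← e2, ← pow_mul, mul_comm, pow_mul, e1, one_pow]
    exact ZMod.neg_one_ne_one e3
end

section
/- For every integer b ≥ 2, the set of positive integers y for which there exist a positive integer ℓ and a positive integer c with b^{ℓ−1} ≤ c < b^ℓ and y² = c·(b^ℓ + 1) is infinite. -/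
theorem aux_d (b : ℕ) (hb : 2 ≤ b) : ∃ d : ℕ, 5 ≤ d ∧ Odd d ∧ d ∣ b ^ 2 + 1 := by
  rcases Nat.even_or_odd' b with ⟨k, rfl | rfl⟩
  · exact ⟨(2 * k) ^ 2 + 1, by nlinarith, ⟨2 * k ^ 2, by ring⟩, dvd_rfl⟩
  · have : 1 ≤ k := by omega
    exact ⟨2 * k ^ 2 + 2 * k + 1, by nlinarith, ⟨k ^ 2 + k, by ring⟩, ⟨2, by ring⟩⟩

theorem aux_sq (x d : ℕ) (hd : Odd d) (h : d ∣ x + 1) : d ^ 2 ∣ x ^ d + 1 := by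
  have h1 : (d : ℤ) ∣ (x : ℤ) - (-1) := by
    rw [sub_neg_eq_add]; exact_mod_cast h
  have h2 := dvd_sub_pow_of_dvd_sub h1 1
  rw [pow_one, hd.neg_one_pow, sub_neg_eq_add] at h2
  exact_mod_cast h2

theorem infinitely_many_y_square_double_block (b : ℕ) (hb : 2 ≤ b) :
    {y : ℕ | 0 < y ∧ ∃ ℓ c : ℕ, 0 < ℓ ∧ 0 < c ∧
      b ^ (ℓ - 1) ≤ c ∧ c < b ^ ℓ ∧ y ^ 2 = c * (b ^ ℓ + 1)}.Infinite := by
  obtain ⟨d, hd5, hodd, hdvd⟩ := aux_d b hb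
  apply Set.infinite_of_forall_exists_gt
  intro n
  have hm : Odd (2 * n + 1) := ⟨n, rfl⟩
  have h1 : d ^ 2 ∣ b ^ (2 * d * (2 * n + 1)) + 1 := by
    refine (aux_sq _ d hodd hdvd).trans ?_
    have := hm.nat_add_dvd_pow_add_pow ((b ^ 2) ^ d) 1
    rw [one_pow, ← pow_mul, ← pow_mul] at this
    rwa [← pow_mul]
  obtain ⟨l, hl⟩ : ∃ l, 2 * d * (2 * n + 1) = l + 1 :=
    Nat.exists_eq_succ_of_ne_zero (by positivity)
  rw [hl] at h1
  obtain ⟨q, hq⟩ := h1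
  obtain ⟨e, rfl⟩ : ∃ e, d = e + 1 := ⟨d - 1, by omega⟩
  have he : 4 ≤ e := by omega
  have hq0 : 0 < q := by
    rcases Nat.eq_zero_or_pos q with rfl | h
    · simp at hq
    · exact h
  have hlt : l + 1 < b ^ (l + 1) := Nat.lt_pow_self (by omega)
  have hln : 2 * n < l + 1 := by rw [← hl]; nlinarith
  have hp : b ^ (l + 1) = b * b ^ l := by ring
  refine ⟨q * (e + 1) * e, ⟨by positivity, l + 1, q * e ^ 2, by omega, by positivity, ?_, ?_, ?_⟩, ?_⟩
  · have h3 : 2 * b ^ l ≤ b * b ^ l := Nat.mul_le_mul_right _ hb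
    have h4 : q * (e + 1) ^ 2 ≤ q * (2 * e ^ 2) := Nat.mul_le_mul_left _ (by nlinarith)
    simp only [Nat.add_sub_cancel]
    nlinarith
  · nlinarith
  · rw [hq]; ring
  · have h4 : q * (e + 1) * (e + 1) ≤ q * (e + 1) * (2 * e) := Nat.mul_le_mul_left _ (by omega)
    nlinarith
end

section
/- The set of pairs (x,y) of positive integers satisfying 3y² = x² + x + 1 is infinite. -/
theorem infinitely_many_points_on_conic :
    {xy : ℕ × ℕ | 0 < xy.1 ∧ 0 < xy.2 ∧
      3 * xy.2 ^ 2 = xy.1 ^ 2 + xy.1 + 1}.Infinite := by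
  have key : ∀ n : ℕ, ∃ x y : ℕ, n < x ∧ 0 < y ∧ 3 * y ^ 2 = x ^ 2 + x + 1 := by
    intro n
    induction n with
    | zero => exact ⟨1, 1, by norm_num⟩
    | succ k ih =>
      obtain ⟨x, y, hx, hy, h⟩ := ih
      exact ⟨7 * x + 12 * y + 3, 4 * x + 7 * y + 2, by omega, by omega, by nlinarith⟩
  apply Set.Infinite.of_image Prod.fst
  apply Set.infinite_of_forall_exists_gt
  intro n
  obtain ⟨x, y, hx, hy, h⟩ := key n
  exact ⟨x, ⟨(x, y), ⟨by simp only; omega, hy, h⟩, rfl⟩, hx⟩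
end

section
/- The set of integers b ≥ 2 for which there exist positive integers y and c with 1 ≤ c < b and y² = c·(b² + b + 1) is infinite. -/
theorem pell_aux (n : ℕ) : ∃ b s : ℕ, n + 8 ≤ b ∧ 0 < s ∧ 7 * s ^ 2 = b ^ 2 + b + 1 := by
  induction n with
  | zero => exact ⟨18, 7, by norm_num, by norm_num, by norm_num⟩
  | succ n ih =>
    obtain ⟨b, s, hb, hs, h⟩ := ih
    refine ⟨127 * b + 63 + 336 * s, 48 * b + 24 + 127 * s, by omega, by omega, ?_⟩
    nlinarith [h]

theorem infinitely_many_bases_231 :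
    {b : ℕ | 2 ≤ b ∧ ∃ y c : ℕ, 0 < y ∧ 1 ≤ c ∧ c < b ∧
      y ^ 2 = c * (b ^ 2 + b + 1)}.Infinite := by
  rw [Set.infinite_iff_exists_gt]
  intro n
  obtain ⟨b, s, hb, hs, h⟩ := pell_aux n
  refine ⟨b, ⟨by omega, 7 * s, 7, by omega, by omega, by omega, ?_⟩, by omega⟩
  rw [← h]; ring
end

section
/- The set of pairs (x,y) of positive integers satisfying 3y² = x² + x + 1 and such that 49 divides x² − x + 1 is infinite. -/
theorem conic_step (x y c b : ℕ) (hc : (2 * c + 1) ^ 2 = 12 * b ^ 2 + 1)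
    (h : 3 * y ^ 2 = x ^ 2 + x + 1) :
    3 * ((2 * c + 1) * y + b * (2 * x + 1)) ^ 2 =
      ((2 * c + 1) * x + 6 * b * y + c) ^ 2 + ((2 * c + 1) * x + 6 * b * y + c) + 1 := by
  zify at *
  have hc' : (c : ℤ) ^ 2 + c = 3 * b ^ 2 := by linarith
  linear_combination ((2 * c + 1 : ℤ) ^ 2 - 12 * b ^ 2) * h + 3 * hc'

theorem infinitely_many_points_on_conic_with_divisibility :
    {xy : ℕ × ℕ | 0 < xy.1 ∧ 0 < xy.2 ∧
      3 * xy.2 ^ 2 = xy.1 ^ 2 + xy.1 + 1 ∧ 49 ∣ xy.1 ^ 2 - xy.1 + 1}.Infinite := by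
  have key : ∀ n : ℕ, ∃ x y : ℕ, n < x ∧ 0 < y ∧ 3 * y ^ 2 = x ^ 2 + x + 1 ∧ x % 49 = 19 := by
    intro n
    induction n with
    | zero => exact ⟨313, 181, by norm_num⟩
    | succ n ih =>
      obtain ⟨x, y, hx, hy, h, hm⟩ := ih
      refine ⟨_, _, ?_, ?_, conic_step x y 26730228454204365035835498694848 15432704593535084340546524763272 (by norm_num) h, ?_⟩ <;> omega
  refine Set.Infinite.of_image Prod.fst (Set.infinite_of_not_bddAbove ?_)
  rintro ⟨B, hB⟩
  obtain ⟨x, y, hx, hy, h, hm⟩ := key B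
  have := hB (Set.mem_image_of_mem Prod.fst (show (x, y) ∈ _ from ⟨by simp; omega, hy, h, ?_⟩))
  · simp at this; omega
  · obtain ⟨k, rfl⟩ : ∃ k, x = 49 * k + 19 := ⟨x / 49, by omega⟩
    refine ⟨49 * k ^ 2 + 37 * k + 7, ?_⟩
    have : (49 * k + 19) ^ 2 = 49 * (49 * k ^ 2 + 37 * k + 7) - 1 + (49 * k + 19) := by
      have : 49 * (49 * k ^ 2 + 37 * k + 7) - 1 = 49 * (49 * k ^ 2 + 37 * k + 6) + 48 := by omega
      rw [this]; ring
    dsimp only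
    rw [this]; omega
end

section
/- The set of integers b ≥ 2 for which there exist positive integers y and c with b ≤ c < b² and y² = c·(b⁴ + b² + 1) is infinite. -/
theorem aux_pell (N : ℕ) : ∃ b m : ℕ, N + 300 < b ∧ b % 49 = 19 ∧ m % 49 = 34 ∧
    b ^ 2 + b + 1 = 3 * m ^ 2 := by
  induction N with
  | zero => exact ⟨313, 181, by norm_num, by norm_num, by norm_num, by norm_num⟩
  | succ N ih =>
    obtain ⟨b, m, h1, h2, h3, h4⟩ := ih
    refine ⟨53460456908408730071670997389697 * b + 92596227561210506043279148579632 * m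
        + 26730228454204365035835498694848,
      30865409187070168681093049526544 * b + 53460456908408730071670997389697 * m
        + 15432704593535084340546524763272, by omega, by omega, by omega, ?_⟩
    zify at h4 ⊢
    linear_combination h4

theorem infinitely_many_bases_232 :
    {b : ℕ | 2 ≤ b ∧ ∃ y c : ℕ, 0 < y ∧ 0 < c ∧ b ≤ c ∧ c < b ^ 2 ∧
      y ^ 2 = c * (b ^ 4 + b ^ 2 + 1)}.Infinite := by
  rw [Set.infinite_iff_exists_gt]
  intro N
  obtain ⟨b, m, h1, h2, h3, h4⟩ := aux_pell N
  refine ⟨b, ⟨by omega, ?_⟩, by omega⟩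
  obtain ⟨k, rfl⟩ : ∃ k, b = 49 * k + 19 := ⟨b / 49, by omega⟩
  have hk : 5 ≤ k := by omega
  have hm : 0 < m := by omega
  -- b^2 - b + 1 = 49 * (49 k^2 + 37 k + 7)
  refine ⟨3 * m * 7 * (49 * k ^ 2 + 37 * k + 7), 3 * (49 * k ^ 2 + 37 * k + 7),
    by positivity, by positivity, by nlinarith, by nlinarith, ?_⟩
  zify at h4 ⊢
  linear_combination (-(3 * 49 * (49 * (k:ℤ) ^ 2 + 37 * k + 7) ^ 2)) * h4
end

section
/- The set of pairs (x,y) of positive integers satisfying 343y² = x² + x + 1 and x > y is infinite. -/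
theorem infinitely_many_points_on_conic_343 :
    {xy : ℕ × ℕ | 0 < xy.2 ∧ xy.2 < xy.1 ∧
      343 * xy.2 ^ 2 = xy.1 ^ 2 + xy.1 + 1}.Infinite := by
  have key : ∀ n : ℕ, ∃ x y : ℕ, n < x ∧ 0 < y ∧ y < x ∧ 343 * y ^ 2 = x ^ 2 + x + 1 := by
    intro n
    induction n with
    | zero => exact ⟨18, 1, by norm_num⟩
    | succ n ih =>
      obtain ⟨x, y, h1, h2, h3, h4⟩ := ih
      refine ⟨34100354867927167 * x + 631547410197102672 * y + 17050177433963583,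
        34100354867927167 * y + 1841246093869104 * x + 920623046934552,
        by omega, by omega, by omega, ?_⟩
      zify at h4 ⊢
      linear_combination h4
  apply Set.Infinite.of_image Prod.fst
  apply Set.infinite_of_forall_exists_gt
  intro n
  obtain ⟨x, y, h1, h2, h3, h4⟩ := key n
  exact ⟨x, ⟨(x, y), ⟨h2, h3, h4⟩, rfl⟩, h1⟩
end

section
/- The set of integers b ≥ 2 for which there exist positive integers y and c with 1 ≤ c < b and y³ = c·(b² + b + 1) is infinite. -/
theorem pell_family_331 (n : ℕ) :
    ∃ b s : ℕ, n < b ∧ 18 ≤ b ∧ 1 ≤ s ∧ b ^ 2 + b + 1 = 343 * s ^ 2 := by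
  induction n with
  | zero => exact ⟨18, 1, by norm_num, by norm_num, by norm_num, by norm_num⟩
  | succ n ih =>
    obtain ⟨b, s, h1, h2, h3, h4⟩ := ih
    refine ⟨34100354867927167 * b + 17050177433963583 + 686 * 920623046934552 * s,
      34100354867927167 * s + 920623046934552 * (2 * b + 1), by omega, by omega, by omega, ?_⟩
    zify at h4 ⊢
    linear_combination h4

theorem infinitely_many_bases_331 :
    {b : ℕ | 2 ≤ b ∧ ∃ y c : ℕ, 0 < y ∧ 1 ≤ c ∧ c < b ∧
      y ^ 3 = c * (b ^ 2 + b + 1)}.Infinite := by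
  refine Set.infinite_of_forall_exists_gt fun n => ?_
  obtain ⟨b, s, h1, h2, h3, h4⟩ := pell_family_331 n
  refine ⟨b, ⟨by omega, 7 * s, s, by omega, h3, ?_, ?_⟩, h1⟩
  · by_contra h
    push Not at h
    nlinarith
  · rw [h4]; ring
end

section
/- Let b ≥ 2 and let y, c be positive integers with 1 ≤ c < b and y³ = c·(b² + b + 1). Set b' = b + 1, y' = y·(b + 2), and c' = c·(b + 2)². Then y'³ = c'·(b'³ + 1) and b'² ≤ c' < b'³. -/
theorem solution_331_to_323 (b y c : ℕ) (hb : 2 ≤ b) (hy : 0 < y) (hc1 : 1 ≤ c)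
    (hcb : c < b) (h : y ^ 3 = c * (b ^ 2 + b + 1)) :
    (y * (b + 2)) ^ 3 = (c * (b + 2) ^ 2) * ((b + 1) ^ 3 + 1) ∧
      (b + 1) ^ 2 ≤ c * (b + 2) ^ 2 ∧ c * (b + 2) ^ 2 < (b + 1) ^ 3 := by
  refine ⟨?_, ?_, ?_⟩
  · rw [mul_pow, h]; ring
  · have := Nat.mul_le_mul_right ((b + 2) ^ 2) hc1
    nlinarith
  · have := Nat.mul_le_mul_right ((b + 2) ^ 2) (Nat.succ_le_of_lt hcb)
    rw [Nat.succ_mul] at this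
    nlinarith
end

section
/- The set of pairs (x,y) of positive integers satisfying 2y² = x² + 1 and such that 13 divides y is infinite. -/
theorem infinitely_many_pell_points_13_dvd :
    {xy : ℕ × ℕ | 0 < xy.1 ∧ 0 < xy.2 ∧
      2 * xy.2 ^ 2 = xy.1 ^ 2 + 1 ∧ 13 ∣ xy.2}.Infinite := by
  have key : ∀ n : ℕ, ∃ x y : ℕ, n < y ∧ 0 < x ∧ 2 * y ^ 2 = x ^ 2 + 1 ∧ 13 ∣ y := by
    intro n
    induction n with
    | zero => exact ⟨239, 169, by norm_num, by norm_num, by norm_num, by norm_num⟩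
    | succ n ih =>
      obtain ⟨x, y, h1, h2, h3, k, rfl⟩ := ih
      refine ⟨114243 * x + 161564 * (13 * k), 80782 * x + 114243 * (13 * k),
        by omega, by omega, by nlinarith, ?_⟩
      exact ⟨6214 * x + 114243 * k, by ring⟩
  apply Set.Infinite.of_image Prod.snd
  apply Set.infinite_of_forall_exists_gt
  intro n
  obtain ⟨x, y, h1, h2, h3, h4⟩ := key n
  exact ⟨y, ⟨(x, y), ⟨h2, by show 0 < y; omega, h3, h4⟩, rfl⟩, h1⟩
end

section
/- For all integers b ≥ 2 and ℓ ≥ 2, there exist a positive integer y and digits d₀, d₁, …, d_{ℓ−1} with 1 ≤ dᵢ ≤ b for each i, such that y² = (∑_{i=0}^{ℓ−1} dᵢ·bⁱ)·(b^ℓ + 1). -/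
theorem digit_sum_aux (b n : ℕ) (hb : 2 ≤ b) :
    ∑ i ∈ Finset.range (n + 2),
      (if i = 0 then 1 else if i = 1 then b else b - 1) * b ^ i = b ^ (n + 2) + 1 := by
  induction n with
  | zero => simp [Finset.sum_range_succ]; ring
  | succ k ih =>
    rw [Finset.sum_range_succ, ih]
    obtain ⟨c, rfl⟩ : ∃ c, b = c + 1 := ⟨b - 1, by omega⟩
    simp
    ring

theorem bijective_base_square_double_block (b ℓ : ℕ) (hb : 2 ≤ b) (hℓ : 2 ≤ ℓ) :
    ∃ (y : ℕ) (d : Fin ℓ → ℕ), 0 < y ∧ (∀ i, 1 ≤ d i ∧ d i ≤ b) ∧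
      y ^ 2 = (∑ i : Fin ℓ, d i * b ^ (i : ℕ)) * (b ^ ℓ + 1) := by
  obtain ⟨n, rfl⟩ : ∃ n, ℓ = n + 2 := ⟨ℓ - 2, by omega⟩
  refine ⟨b ^ (n + 2) + 1,
    fun i => if (i : ℕ) = 0 then 1 else if (i : ℕ) = 1 then b else b - 1,
    by omega, ?_, ?_⟩
  · intro i
    dsimp only
    split_ifs <;> omega
  · rw [Fin.sum_univ_eq_sum_range
      (fun i => (if i = 0 then 1 else if i = 1 then b else b - 1) * b ^ i) (n + 2),
      digit_sum_aux b n hb]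
    ring
end

section
/- For every integer n ≥ 1, the following Fibonacci identity holds: (F(4n+3) + F(4n+6) + F(8n+8) + F(8n+11))² = F(4n+2) + F(4n+5) + F(4n+8) + F(4n+10) + (∑_{i=1}^{n−1} F(4n+4i+10)) + F(8n+11) + F(12n+12) + F(12n+15) + F(12n+18) + F(12n+20) + (∑_{i=1}^{n−1} F(12n+4i+20)) + F(16n+21). -/
lemma aux_sum (c m : ℕ) : 5 * (∑ i ∈ Finset.Icc 1 m, (Nat.fib (c+4*i) : ℤ)) =
    Nat.fib (c+4*m+1) + Nat.fib (c+4*m+3) - Nat.fib (c+1) - Nat.fib (c+3) := by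
  induction m with
  | zero => simp
  | succ m ih =>
    rw [Finset.sum_Icc_succ_top (by omega), mul_add, ih]
    have e : c + 4*(m+1) = c+4*m+4 := by ring
    rw [e]
    generalize c+4*m = k
    simp only [Nat.fib_add_two, Nat.cast_add, show k+4+1 = k+3+2 from rfl, show k+4+3 = k+5+2 from rfl,
      show k+5 = k+3+2 from rfl, show k+6 = k+4+2 from rfl, show k+4=k+2+2 from rfl, show k+3=k+1+2 from rfl,
      show k+5+1 = k+4+2 from rfl, show k+3+1 = k+2+2 from rfl, show k+2+1 = k+1+2 from rfl, show k+1+1=k+2 from rfl]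
    ring

lemma aux_shift (N k : ℕ) : (Nat.fib (N+(k+1)) : ℤ) =
    Nat.fib N * Nat.fib k + Nat.fib (N+1) * Nat.fib (k+1) := by
  have := Nat.fib_add N k
  rw [← add_assoc]; exact_mod_cast this

lemma aux_zero (N M : ℕ) : (Nat.fib (N+M) : ℤ) =
    Nat.fib N * (Nat.fib (M+1) - Nat.fib M) + Nat.fib (N+1) * Nat.fib M := by
  have h1 := aux_shift N M
  have h2 := aux_shift N (M+1)
  have h3 : Nat.fib (N+(M+1+1)) = Nat.fib (N+M) + Nat.fib (N+(M+1)) := Nat.fib_add_two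
  have h4 : Nat.fib (M+1+1) = Nat.fib M + Nat.fib (M+1) := Nat.fib_add_two
  rw [h3, h4] at h2
  push_cast at h2
  linear_combination h2 - h1

lemma aux_norm (n : ℕ) : (Nat.fib (4*n+1) : ℤ)^2 - Nat.fib (4*n) * Nat.fib (4*n+1)
    - (Nat.fib (4*n) : ℤ)^2 = 1 := by
  induction n with
  | zero => simp
  | succ n ih =>
    rw [show 4*(n+1)+1 = 4*n+(4+1) by ring, show 4*(n+1) = 4*n+(3+1) by ring,
      aux_shift, aux_shift]
    norm_num [Nat.fib_add_two]
    linear_combination ih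

set_option maxHeartbeats 1000000 in
open Nat in
theorem fibonacci_identity (n : ℕ) (hn : 1 ≤ n) :
    (fib (4*n+3) + fib (4*n+6) + fib (8*n+8) + fib (8*n+11)) ^ 2 =
      fib (4*n+2) + fib (4*n+5) + fib (4*n+8) + fib (4*n+10) +
        (∑ i ∈ Finset.Icc 1 (n-1), fib (4*n+4*i+10)) + fib (8*n+11) +
      fib (12*n+12) + fib (12*n+15) + fib (12*n+18) + fib (12*n+20) +
        (∑ i ∈ Finset.Icc 1 (n-1), fib (12*n+4*i+20)) + fib (16*n+21) := by
  have s1 := aux_sum (4*n+10) (n-1)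
  have s2 := aux_sum (12*n+20) (n-1)
  rw [show 4*n+10+4*(n-1)+1 = 8*n+7 by omega, show 4*n+10+4*(n-1)+3 = 8*n+9 by omega] at s1
  rw [show 12*n+20+4*(n-1)+1 = 16*n+17 by omega, show 12*n+20+4*(n-1)+3 = 16*n+19 by omega] at s2
  simp only [add_right_comm (4*n) 10 _] at s1
  simp only [add_right_comm (12*n) 20 _] at s2
  have hN := aux_norm n
  have h8 := aux_zero (4*n) (4*n)
  have h8' := aux_shift (4*n) (4*n)
  have h12 := aux_zero (8*n) (4*n)
  have h12' := aux_shift (8*n) (4*n)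
  have h16 := aux_zero (12*n) (4*n)
  have h16' := aux_shift (12*n) (4*n)
  rw [show 4*n+4*n = 8*n by ring] at h8
  rw [show 4*n+(4*n+1) = 8*n+1 by ring] at h8'
  rw [show 8*n+4*n = 12*n by ring] at h12
  rw [show 8*n+(4*n+1) = 12*n+1 by ring] at h12'
  rw [show 12*n+4*n = 16*n by ring] at h16
  rw [show 12*n+(4*n+1) = 16*n+1 by ring] at h16'
  zify
  generalize (∑ i ∈ Finset.Icc 1 (n-1), (fib (4*n+4*i+10) : ℤ)) = S1 at *
  generalize (∑ i ∈ Finset.Icc 1 (n-1), (fib (12*n+4*i+20) : ℤ)) = S2 at *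
  simp only [add_assoc, Nat.reduceAdd] at s1 s2
  have f4_2 : (fib (4*n+2) : ℤ) = fib (4*n) * 1 + fib (4*n+1) * 1 := by
    have := aux_shift (4*n) 1
    rw [show fib 1 = 1 by norm_num, show fib (1+1) = 1 by norm_num] at this
    exact this
  have f4_3 : (fib (4*n+3) : ℤ) = fib (4*n) * 1 + fib (4*n+1) * 2 := by
    have := aux_shift (4*n) 2
    rw [show fib 2 = 1 by norm_num, show fib (2+1) = 2 by norm_num] at this
    exact this
  have f4_5 : (fib (4*n+5) : ℤ) = fib (4*n) * 3 + fib (4*n+1) * 5 := by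
    have := aux_shift (4*n) 4
    rw [show fib 4 = 3 by norm_num, show fib (4+1) = 5 by norm_num] at this
    exact this
  have f4_6 : (fib (4*n+6) : ℤ) = fib (4*n) * 5 + fib (4*n+1) * 8 := by
    have := aux_shift (4*n) 5
    rw [show fib 5 = 5 by norm_num, show fib (5+1) = 8 by norm_num] at this
    exact this
  have f4_8 : (fib (4*n+8) : ℤ) = fib (4*n) * 13 + fib (4*n+1) * 21 := by
    have := aux_shift (4*n) 7
    rw [show fib 7 = 13 by norm_num, show fib (7+1) = 21 by norm_num] at this
    exact this
  have f4_10 : (fib (4*n+10) : ℤ) = fib (4*n) * 34 + fib (4*n+1) * 55 := by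
    have := aux_shift (4*n) 9
    rw [show fib 9 = 34 by norm_num, show fib (9+1) = 55 by norm_num] at this
    exact this
  have f4_11 : (fib (4*n+11) : ℤ) = fib (4*n) * 55 + fib (4*n+1) * 89 := by
    have := aux_shift (4*n) 10
    rw [show fib 10 = 55 by norm_num, show fib (10+1) = 89 by norm_num] at this
    exact this
  have f4_13 : (fib (4*n+13) : ℤ) = fib (4*n) * 144 + fib (4*n+1) * 233 := by
    have := aux_shift (4*n) 12
    rw [show fib 12 = 144 by norm_num, show fib (12+1) = 233 by norm_num] at this
    exact this
  have f8_7 : (fib (8*n+7) : ℤ) = fib (8*n) * 8 + fib (8*n+1) * 13 := by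
    have := aux_shift (8*n) 6
    rw [show fib 6 = 8 by norm_num, show fib (6+1) = 13 by norm_num] at this
    exact this
  have f8_8 : (fib (8*n+8) : ℤ) = fib (8*n) * 13 + fib (8*n+1) * 21 := by
    have := aux_shift (8*n) 7
    rw [show fib 7 = 13 by norm_num, show fib (7+1) = 21 by norm_num] at this
    exact this
  have f8_9 : (fib (8*n+9) : ℤ) = fib (8*n) * 21 + fib (8*n+1) * 34 := by
    have := aux_shift (8*n) 8
    rw [show fib 8 = 21 by norm_num, show fib (8+1) = 34 by norm_num] at this
    exact this
  have f8_11 : (fib (8*n+11) : ℤ) = fib (8*n) * 55 + fib (8*n+1) * 89 := by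
    have := aux_shift (8*n) 10
    rw [show fib 10 = 55 by norm_num, show fib (10+1) = 89 by norm_num] at this
    exact this
  have f12_12 : (fib (12*n+12) : ℤ) = fib (12*n) * 89 + fib (12*n+1) * 144 := by
    have := aux_shift (12*n) 11
    rw [show fib 11 = 89 by norm_num, show fib (11+1) = 144 by norm_num] at this
    exact this
  have f12_15 : (fib (12*n+15) : ℤ) = fib (12*n) * 377 + fib (12*n+1) * 610 := by
    have := aux_shift (12*n) 14
    rw [show fib 14 = 377 by norm_num, show fib (14+1) = 610 by norm_num] at this
    exact this
  have f12_18 : (fib (12*n+18) : ℤ) = fib (12*n) * 1597 + fib (12*n+1) * 2584 := by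
    have := aux_shift (12*n) 17
    rw [show fib 17 = 1597 by norm_num, show fib (17+1) = 2584 by norm_num] at this
    exact this
  have f12_20 : (fib (12*n+20) : ℤ) = fib (12*n) * 4181 + fib (12*n+1) * 6765 := by
    have := aux_shift (12*n) 19
    rw [show fib 19 = 4181 by norm_num, show fib (19+1) = 6765 by norm_num] at this
    exact this
  have f12_21 : (fib (12*n+21) : ℤ) = fib (12*n) * 6765 + fib (12*n+1) * 10946 := by
    have := aux_shift (12*n) 20
    rw [show fib 20 = 6765 by norm_num, show fib (20+1) = 10946 by norm_num] at this
    exact this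
  have f12_23 : (fib (12*n+23) : ℤ) = fib (12*n) * 17711 + fib (12*n+1) * 28657 := by
    have := aux_shift (12*n) 22
    rw [show fib 22 = 17711 by norm_num, show fib (22+1) = 28657 by norm_num] at this
    exact this
  have f16_17 : (fib (16*n+17) : ℤ) = fib (16*n) * 987 + fib (16*n+1) * 1597 := by
    have := aux_shift (16*n) 16
    rw [show fib 16 = 987 by norm_num, show fib (16+1) = 1597 by norm_num] at this
    exact this
  have f16_19 : (fib (16*n+19) : ℤ) = fib (16*n) * 2584 + fib (16*n+1) * 4181 := by
    have := aux_shift (16*n) 18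
    rw [show fib 18 = 2584 by norm_num, show fib (18+1) = 4181 by norm_num] at this
    exact this
  have f16_21 : (fib (16*n+21) : ℤ) = fib (16*n) * 6765 + fib (16*n+1) * 10946 := by
    have := aux_shift (16*n) 20
    rw [show fib 20 = 6765 by norm_num, show fib (20+1) = 10946 by norm_num] at this
    exact this
  simp only [f4_2, f4_3, f4_5, f4_6, f4_8, f4_10, f4_11, f4_13, f8_7, f8_8, f8_9, f8_11, f12_12, f12_15, f12_18, f12_20, f12_21, f12_23, f16_17, f16_19, f16_21] at s1 s2 ⊢
  rw [h16, h16', h12, h12', h8, h8'] at s2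
  rw [h8, h8'] at s1
  rw [h16, h16', h12, h12', h8, h8']
  generalize (fib (4*n) : ℤ) = a at *
  generalize (fib (4*n+1) : ℤ) = b at *
  apply mul_left_cancel₀ (show (5:ℤ) ≠ 0 by norm_num)
  linear_combination ((-8)*a^0*b^2 + (88)*a^0*b^1 + (8)*a^1*b^1 + (56)*a^1*b^0 + (8)*a^2*b^0) * hN - s1 - s2
end
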